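/- arXiv:2603.10503 — 2 statements merged into one kernel-verified Lean document; each statement's English description precedes it below -/
import Mathlib

section
/- Let X ∈ ℝ^{I1×I2×I3} and let X_R = U_R * S_R * V_R^T be the rank-R truncated T-SVD obtained by truncating the matrix SVD of each Fourier slice to its top R singular values. Then ‖X − X_R‖_F² = (1/I3) Σ_{t=1}^{I3} Σ_{k>R} σ_k(X̂(:,:,t))², where σ_k denotes the k-th singular value; in particular, X_R is a best approximation of X among all tensors of tubal rank at most R in the Frobenius norm. -/
open scoped BigOperators

namespace TTT

/-- Circular convolution of two length-`T` vectors. -/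
def cconv {T : ℕ} (x y : Fin T → ℝ) : Fin T → ℝ := fun k => ∑ m, x m * y (k - m)

/-- The t-product, defined tube-wise via circular convolution. -/
def tprod {I1 I2 I4 T : ℕ} (X : Fin I1 → Fin I2 → Fin T → ℝ)
    (Y : Fin I2 → Fin I4 → Fin T → ℝ) : Fin I1 → Fin I4 → Fin T → ℝ :=
  fun i k => ∑ j, cconv (X i j) (Y j k)

/-- Unnormalized discrete Fourier transform of a length-`T` real vector. -/
noncomputable def dftR {T : ℕ} (x : Fin T → ℝ) (k : Fin T) : ℂ :=
  ∑ m, (x m : ℂ) * Complex.exp (-2 * (Real.pi : ℂ) * Complex.I * ((k : ℕ) : ℂ) * ((m : ℕ) : ℂ) / ((T : ℕ) : ℂ))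

/-- Frobenius norm of a third-order tensor. -/
noncomputable def frob {I1 I2 T : ℕ} (X : Fin I1 → Fin I2 → Fin T → ℝ) : ℝ :=
  Real.sqrt (∑ i, ∑ j, ∑ t, X i j t ^ 2)

/-- The kernel of the discrete Fourier transform of length `n + 1`, as an additive character. -/
noncomputable def dftKernel {n : ℕ} (k m : Fin (n + 1)) : ℂ :=
  ZMod.stdAddChar (N := n + 1) (-((k : ZMod (n + 1)) * (m : ZMod (n + 1))))

theorem dftR_eq_sum_dftKernel {n : ℕ} (x : Fin (n + 1) → ℝ) (k : Fin (n + 1)) :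
    dftR x k = ∑ m, (x m : ℂ) * dftKernel k m := by
  unfold dftR dftKernel
  refine Finset.sum_congr rfl fun m _ => ?_
  have hcast (a : Fin (n + 1)) : (((a : ℕ) : ℤ) : ZMod (n + 1)) = (a : ZMod (n + 1)) := by
    rw [Int.cast_natCast]
    exact ZMod.natCast_zmod_val (n := n + 1) a
  have h : (-((k : ZMod (n + 1)) * (m : ZMod (n + 1))))
      = ((-(((k : ℕ) : ℤ) * ((m : ℕ) : ℤ)) : ℤ) : ZMod (n + 1)) := by
    rw [Int.cast_neg, Int.cast_mul, hcast, hcast]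
    rfl
  rw [h, ZMod.stdAddChar_coe]
  congr 2
  push_cast
  ring

theorem dftKernel_add {n : ℕ} (k a b : Fin (n + 1)) :
    dftKernel k (a + b) = dftKernel k a * dftKernel k b := by
  have h (k a b : ZMod (n + 1)) : ZMod.stdAddChar (-(k * (a + b)))
      = ZMod.stdAddChar (-(k * a)) * ZMod.stdAddChar (-(k * b)) := by
    rw [← AddChar.map_add_eq_mul]
    congr 1
    ring
  exact h k a b

theorem sum_dftKernel_mul_conj {n : ℕ} (a b : Fin (n + 1)) :
    ∑ k, dftKernel k a * starRingEnd ℂ (dftKernel k b)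
      = if a = b then ((n + 1 : ℕ) : ℂ) else 0 := by
  have key (a b : ZMod (n + 1)) :
      ∑ k : ZMod (n + 1), ZMod.stdAddChar (-(k * a))
          * starRingEnd ℂ (ZMod.stdAddChar (-(k * b)))
        = if a = b then ((n + 1 : ℕ) : ℂ) else 0 := by
    have h : ∀ k : ZMod (n + 1), ZMod.stdAddChar (-(k * a))
          * starRingEnd ℂ (ZMod.stdAddChar (-(k * b)))
        = ZMod.stdAddChar (k * (b - a)) := fun k => by
      rw [← AddChar.map_neg_eq_conj, ← AddChar.map_add_eq_mul]
      congr 1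
      ring
    simp_rw [h]
    rw [AddChar.sum_mulShift _ (ZMod.isPrimitive_stdAddChar (n + 1))]
    simp only [ZMod.card, sub_eq_zero, eq_comm (a := b)]
    split_ifs <;> simp
  exact key a b

/-- Parseval's identity for the unnormalized discrete Fourier transform. -/
theorem sum_norm_dftR_sq {T : ℕ} (x : Fin T → ℝ) :
    ∑ t, ‖dftR x t‖ ^ 2 = T * ∑ m, x m ^ 2 := by
  obtain _ | n := T
  · simp
  apply Complex.ofReal_injective
  push_cast
  simp_rw [← Complex.mul_conj', dftR_eq_sum_dftKernel, map_sum, Finset.sum_mul_sum, map_mul,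
    Complex.conj_ofReal]
  rw [Finset.sum_comm, Finset.mul_sum]
  refine Finset.sum_congr rfl fun a _ => ?_
  rw [Finset.sum_comm]
  have h (b : Fin (n + 1)) :
      ∑ k, (x a : ℂ) * dftKernel k a * ((x b : ℂ) * starRingEnd ℂ (dftKernel k b))
        = (x a : ℂ) * x b * if a = b then ((n + 1 : ℕ) : ℂ) else 0 := by
    rw [← sum_dftKernel_mul_conj, Finset.mul_sum]
    exact Finset.sum_congr rfl fun k _ => by ring
  simp_rw [h, mul_ite, mul_zero, Finset.sum_ite_eq, Finset.mem_univ, if_true]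
  push_cast
  ring

theorem dftR_sub {T : ℕ} (x y : Fin T → ℝ) (t : Fin T) :
    dftR (fun m => x m - y m) t = dftR x t - dftR y t := by
  simp only [dftR, Complex.ofReal_sub, sub_mul, Finset.sum_sub_distrib]

theorem dftR_sum {ι : Type*} {T : ℕ} (S : Finset ι) (x : ι → Fin T → ℝ) (t : Fin T) :
    dftR (∑ l ∈ S, x l) t = ∑ l ∈ S, dftR (x l) t := by
  simp only [dftR, Finset.sum_apply, Complex.ofReal_sum, Finset.sum_mul]
  exact Finset.sum_comm

/-- The discrete Fourier transform turns circular convolution into multiplication. -/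
theorem dftR_cconv {T : ℕ} (x y : Fin T → ℝ) (t : Fin T) :
    dftR (cconv x y) t = dftR x t * dftR y t := by
  obtain _ | n := T
  · exact t.elim0
  simp only [dftR_eq_sum_dftKernel, cconv, Complex.ofReal_sum, Complex.ofReal_mul,
    Finset.sum_mul]
  rw [Finset.sum_comm]
  refine Finset.sum_congr rfl fun a _ => ?_
  rw [← Equiv.sum_comp (Equiv.addLeft a), Finset.mul_sum]
  refine Finset.sum_congr rfl fun b _ => ?_
  rw [Equiv.coe_addLeft, add_sub_cancel_left, dftKernel_add]
  ring

/-- The Fourier slices of a t-product are the matrix products of the Fourier slices. -/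
theorem dftR_tprod {I1 I2 R T : ℕ} (Y : Fin I1 → Fin R → Fin T → ℝ)
    (Z : Fin R → Fin I2 → Fin T → ℝ) (i : Fin I1) (j : Fin I2) (t : Fin T) :
    dftR (tprod Y Z i j) t = ∑ l, dftR (Y i l) t * dftR (Z l j) t := by
  simp only [tprod, dftR_sum, dftR_cconv]

/-- Parseval's identity for the Frobenius norm of a third-order tensor. -/
theorem frob_sq_eq_sum_norm_dftR_sq {I1 I2 T : ℕ} (X : Fin I1 → Fin I2 → Fin T → ℝ) :
    frob X ^ 2 = (1 / (T : ℝ)) * ∑ t, ∑ j, ∑ i, ‖dftR (X i j) t‖ ^ 2 := by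
  have h : ∑ t, ∑ j, ∑ i, ‖dftR (X i j) t‖ ^ 2 = T * ∑ i, ∑ j, ∑ t, X i j t ^ 2 := by
    simp_rw [Finset.mul_sum (s := Finset.univ (α := Fin I1)),
      Finset.mul_sum (s := Finset.univ (α := Fin I2)), ← sum_norm_dftR_sq]
    simp_rw [Finset.sum_comm (s := Finset.univ (α := Fin T))]
    exact Finset.sum_comm
  unfold frob
  rw [Real.sq_sqrt (by positivity), h]
  obtain rfl | hT := Nat.eq_zero_or_pos T
  · simp
  · field_simp

section Slice

variable {E : Type*} [NormedAddCommGroup E] [InnerProductSpace ℂ E]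

/-- Combining vectors by the adjoint of a matrix with orthonormal columns preserves the sum of
squared norms. -/
theorem sum_norm_sum_conj_smul_sq {ι κ : Type*} [Fintype ι] [Fintype κ] [DecidableEq κ]
    (V : ι → κ → ℂ)
    (hV : ∀ k l, (∑ j, starRingEnd ℂ (V j k) * V j l) = if k = l then 1 else 0) (x : κ → E) :
    ∑ j, ‖∑ k, starRingEnd ℂ (V j k) • x k‖ ^ 2 = ∑ k, ‖x k‖ ^ 2 := by
  apply Complex.ofReal_injective
  push_cast
  have hn (y : E) : ((‖y‖ : ℂ)) ^ 2 = inner ℂ y y := (inner_self_eq_norm_sq_to_K y).symm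
  simp_rw [hn, sum_inner, inner_sum, inner_smul_left, inner_smul_right, Complex.conj_conj]
  rw [Finset.sum_comm]
  refine Finset.sum_congr rfl fun k _ => ?_
  rw [Finset.sum_comm]
  have h (l : κ) :
      ∑ j, V j k * (starRingEnd ℂ (V j l) * inner ℂ (x k) (x l))
        = if l = k then inner ℂ (x k) (x l) else 0 := by
    rw [← one_mul (inner ℂ (x k) (x l)), ← zero_mul (inner ℂ (x k) (x l)), ← ite_mul, ← hV,
      Finset.sum_mul]
    exact Finset.sum_congr rfl fun j _ => by ring
  simp_rw [h, Finset.sum_ite_eq', Finset.mem_univ, if_true]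

/-- Bessel's inequality summed over an orthonormal basis of `W`: the squared norms of the
projections of an orthonormal family onto `W` add up to at most `dim W`. -/
theorem sum_norm_starProjection_sq_le_finrank {κ : Type*} [Fintype κ] {u : κ → E}
    (hu : Orthonormal ℂ u) (W : Submodule ℂ E) [FiniteDimensional ℂ W] :
    ∑ k, ‖W.starProjection (u k)‖ ^ 2 ≤ Module.finrank ℂ W := by
  set b := stdOrthonormalBasis ℂ W
  have h (k : κ) : ‖W.starProjection (u k)‖ ^ 2 = ∑ i, ‖inner ℂ (u k) (b i : E)‖ ^ 2 := by
    rw [W.starProjection_apply, ← Submodule.coe_norm, ← b.sum_sq_norm_inner_right]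
    refine Finset.sum_congr rfl fun i _ => ?_
    rw [norm_inner_symm (u k), Submodule.inner_orthogonalProjectionOnto_eq_of_mem_left]
  simp_rw [h]
  rw [Finset.sum_comm]
  calc ∑ i, ∑ k, ‖inner ℂ (u k) (b i : E)‖ ^ 2 ≤ ∑ i, ‖(b i : E)‖ ^ 2 :=
        Finset.sum_le_sum fun i _ => hu.sum_inner_products_le _
    _ = Module.finrank ℂ W := by simp [← Submodule.coe_norm]

/-- Among weights `c k ∈ [0, 1]` of total mass at most `R`, the sum of `(1 - c k) * a k` with `a`
decreasing is smallest when the mass sits on the first `R` indices. -/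
theorem sum_tail_le_sum_one_sub_mul {n R : ℕ} {a c : Fin n → ℝ} (ha : ∀ k, 0 ≤ a k)
    (hmono : Antitone a) (hc0 : ∀ k, 0 ≤ c k) (hc1 : ∀ k, c k ≤ 1) (hc : ∑ k, c k ≤ R) :
    ∑ k : Fin n, (if R ≤ (k : ℕ) then a k else 0) ≤ ∑ k, (1 - c k) * a k := by
  obtain hR | hR := le_or_gt n R
  · refine Finset.sum_le_sum fun k _ => ?_
    rw [if_neg (by omega)]
    exact mul_nonneg (sub_nonneg.2 (hc1 k)) (ha k)
  set τ := a ⟨R, hR⟩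
  have hcount : ∑ k : Fin n, (if (k : ℕ) < R then (1 : ℝ) else 0) = R := by
    rw [Fin.sum_univ_eq_sum_range (fun k => if k < R then (1 : ℝ) else 0), Finset.sum_boole]
    congr 1
    rw [show (Finset.range n).filter (· < R) = Finset.range R by ext; simp; omega,
      Finset.card_range]
  have hterm (k : Fin n) : (if R ≤ (k : ℕ) then a k else 0)
      + τ * ((if (k : ℕ) < R then (1 : ℝ) else 0) - c k) ≤ (1 - c k) * a k := by
    obtain hk | hk := lt_or_ge (k : ℕ) R
    · rw [if_neg (by omega), if_pos hk]
      have : τ ≤ a k := hmono (Fin.le_def.2 hk.le)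
      nlinarith [hc1 k]
    · rw [if_pos hk, if_neg (by omega)]
      have : a k ≤ τ := hmono (Fin.le_def.2 hk)
      nlinarith [hc0 k]
  have hsum := Finset.sum_le_sum fun k (_ : k ∈ Finset.univ) => hterm k
  rw [Finset.sum_add_distrib, ← Finset.mul_sum, Finset.sum_sub_distrib, hcount] at hsum
  have := mul_nonneg (ha ⟨R, hR⟩) (sub_nonneg.2 hc)
  linarith

/-- The Eckart–Young lower bound: if the columns `∑ k, conj (V j k) • s k • u k` of a singular
value decomposition are approximated by vectors of a subspace of dimension at most `R`, the
squared error is at least the sum of the squared singular values beyond the first `R`. -/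
theorem sum_tail_sq_le_sum_norm_sub_sq {ι : Type*} [Fintype ι] {n R : ℕ} (V : ι → Fin n → ℂ)
    (hV : ∀ k l, (∑ j, starRingEnd ℂ (V j k) * V j l) = if k = l then 1 else 0)
    {s : Fin n → ℝ} (hs0 : ∀ k, 0 ≤ s k) (hs : Antitone s) {u : Fin n → E}
    (hu : Orthonormal ℂ u) (W : Submodule ℂ E) [FiniteDimensional ℂ W]
    (hW : Module.finrank ℂ W ≤ R) {b : ι → E} (hb : ∀ j, b j ∈ W) :
    ∑ k : Fin n, (if R ≤ (k : ℕ) then s k ^ 2 else 0)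
      ≤ ∑ j, ‖(∑ k, starRingEnd ℂ (V j k) • (s k : ℂ) • u k) - b j‖ ^ 2 := by
  have hproj (k : Fin n) :
      ‖u k‖ ^ 2 = ‖W.starProjection (u k)‖ ^ 2 + ‖Wᗮ.starProjection (u k)‖ ^ 2 :=
    Submodule.norm_sq_eq_add_norm_sq_starProjection _ _
  simp_rw [hu.norm_eq_one] at hproj
  calc ∑ k : Fin n, (if R ≤ (k : ℕ) then s k ^ 2 else 0)
      ≤ ∑ k, (1 - ‖W.starProjection (u k)‖ ^ 2) * s k ^ 2 :=
        sum_tail_le_sum_one_sub_mul (fun k => sq_nonneg _)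
          (fun k l h => pow_le_pow_left₀ (hs0 l) (hs h) 2) (fun k => sq_nonneg _)
          (fun k => by nlinarith [hproj k, sq_nonneg ‖Wᗮ.starProjection (u k)‖])
          ((sum_norm_starProjection_sq_le_finrank hu W).trans (by exact_mod_cast hW))
    _ = ∑ k, ‖(s k : ℂ) • Wᗮ.starProjection (u k)‖ ^ 2 := by
        refine Finset.sum_congr rfl fun k _ => ?_
        rw [norm_smul, mul_pow, Complex.norm_real, Real.norm_eq_abs, sq_abs]
        linear_combination (s k ^ 2) * hproj k
    _ = ∑ j, ‖∑ k, starRingEnd ℂ (V j k) • (s k : ℂ) • Wᗮ.starProjection (u k)‖ ^ 2 :=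
        (sum_norm_sum_conj_smul_sq V hV _).symm
    _ ≤ _ := by
        refine Finset.sum_le_sum fun j _ => pow_le_pow_left₀ (norm_nonneg _) ?_ 2
        refine le_of_eq_of_le ?_ (Wᗮ.norm_starProjection_apply_le _)
        have hbj : Wᗮ.starProjection (b j) = 0 := by
          rw [Submodule.starProjection_orthogonal_val,
            Submodule.starProjection_eq_self_iff.2 (hb j), sub_self]
        simp only [map_sub, map_sum, map_smul, hbj, sub_zero]

end Slice

theorem orthonormal_toLp_columns {ι κ : Type*} [Fintype ι] [DecidableEq κ] {U : ι → κ → ℂ}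
    (hU : ∀ k l, (∑ i, starRingEnd ℂ (U i k) * U i l) = if k = l then 1 else 0) :
    Orthonormal ℂ fun k => WithLp.toLp 2 fun i => U i k := by
  rw [orthonormal_iff_ite]
  intro k l
  rw [← hU k l, PiLp.inner_apply]
  exact Finset.sum_congr rfl fun i _ => by simp [mul_comm]

/-- The squared Frobenius norm of a matrix given in singular value form. -/
theorem sum_norm_sum_svd_sq {ι ι' κ : Type*} [Fintype ι] [Fintype ι'] [Fintype κ] [DecidableEq κ]
    {U : ι → κ → ℂ} {V : ι' → κ → ℂ}
    (hU : ∀ k l, (∑ i, starRingEnd ℂ (U i k) * U i l) = if k = l then 1 else 0)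
    (hV : ∀ k l, (∑ j, starRingEnd ℂ (V j k) * V j l) = if k = l then 1 else 0) (c : κ → ℝ) :
    ∑ j, ∑ i, ‖∑ k, (c k : ℂ) * U i k * starRingEnd ℂ (V j k)‖ ^ 2 = ∑ k, c k ^ 2 := by
  have h := sum_norm_sum_conj_smul_sq V hV fun k => (c k : ℂ) • WithLp.toLp 2 fun i => U i k
  simp only [norm_smul, (orthonormal_toLp_columns hU).norm_eq_one, mul_one, Complex.norm_real,
    Real.norm_eq_abs, sq_abs] at h
  rw [← h]
  refine Finset.sum_congr rfl fun j _ => ?_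
  rw [EuclideanSpace.norm_sq_eq]
  refine Finset.sum_congr rfl fun i _ => ?_
  simp [mul_comm]

/-- The Eckart–Young lower bound for matrices factoring through an `R`-dimensional space. -/
theorem sum_tail_sq_le_sum_norm_svd_sub_mul_sq {ι ι' : Type*} [Fintype ι] [Fintype ι'] {n R : ℕ}
    {U : ι → Fin n → ℂ} {V : ι' → Fin n → ℂ}
    (hU : ∀ k l, (∑ i, starRingEnd ℂ (U i k) * U i l) = if k = l then 1 else 0)
    (hV : ∀ k l, (∑ j, starRingEnd ℂ (V j k) * V j l) = if k = l then 1 else 0)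
    {s : Fin n → ℝ} (hs0 : ∀ k, 0 ≤ s k) (hs : Antitone s)
    (P : ι → Fin R → ℂ) (Q : Fin R → ι' → ℂ) :
    ∑ k : Fin n, (if R ≤ (k : ℕ) then s k ^ 2 else 0)
      ≤ ∑ j, ∑ i, ‖(∑ k, (s k : ℂ) * U i k * starRingEnd ℂ (V j k)) - ∑ l, P i l * Q l j‖ ^ 2 := by
  set p : Fin R → EuclideanSpace ℂ ι := fun l => WithLp.toLp 2 fun i => P i l
  have hW : Module.finrank ℂ (Submodule.span ℂ (Set.range p)) ≤ R := by
    simpa [Set.finrank] using finrank_range_le_card (R := ℂ) p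
  have hb (j : ι') : ∑ l, Q l j • p l ∈ Submodule.span ℂ (Set.range p) :=
    Submodule.sum_mem _ fun l _ => Submodule.smul_mem _ _ (Submodule.subset_span ⟨l, rfl⟩)
  refine (sum_tail_sq_le_sum_norm_sub_sq V hV hs0 hs (orthonormal_toLp_columns hU) _ hW hb).trans
    (le_of_eq ?_)
  refine Finset.sum_congr rfl fun j _ => ?_
  rw [EuclideanSpace.norm_sq_eq]
  refine Finset.sum_congr rfl fun i _ => ?_
  simp [p, mul_comm]

/-- error formula and Eckart–Young optimality of the rank-`R` truncated T-SVD.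
The slice-wise SVD data of `X̂(:,:,t)` is given by `U, V` (tensors with orthonormal columns)
and decreasingly ordered nonnegative singular values `s t 1 ≥ s t 2 ≥ …`; `XR` is obtained by
truncating each Fourier-slice SVD to its top `R` singular values.  Then
`‖X − XR‖_F² = (1/I3) ∑_t ∑_{k > R} σ_k(X̂(:,:,t))²`, and `XR` is a best Frobenius-norm
approximation of `X` among all tensors of tubal rank at most `R`. -/
theorem truncated_tsvd_error_and_optimality {I1 I2 I3 R : ℕ}
    (X XR : Fin I1 → Fin I2 → Fin I3 → ℝ)
    (U : Fin I3 → Fin I1 → Fin (min I1 I2) → ℂ)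
    (V : Fin I3 → Fin I2 → Fin (min I1 I2) → ℂ)
    (s : Fin I3 → Fin (min I1 I2) → ℝ)
    (hU : ∀ (t : Fin I3) (k l : Fin (min I1 I2)),
      (∑ i, starRingEnd ℂ (U t i k) * U t i l) = if k = l then 1 else 0)
    (hV : ∀ (t : Fin I3) (k l : Fin (min I1 I2)),
      (∑ j, starRingEnd ℂ (V t j k) * V t j l) = if k = l then 1 else 0)
    (hs_nonneg : ∀ t k, 0 ≤ s t k)
    (hs_mono : ∀ (t : Fin I3) (k l : Fin (min I1 I2)), k ≤ l → s t l ≤ s t k)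
    (hX : ∀ (t : Fin I3) (i : Fin I1) (j : Fin I2),
      dftR (X i j) t = ∑ k, (s t k : ℂ) * U t i k * starRingEnd ℂ (V t j k))
    (hXR : ∀ (t : Fin I3) (i : Fin I1) (j : Fin I2),
      dftR (XR i j) t =
        ∑ k : Fin (min I1 I2), if (k : ℕ) < R then (s t k : ℂ) * U t i k * starRingEnd ℂ (V t j k) else 0) :
    (frob (fun i j t => X i j t - XR i j t)) ^ 2
        = (1 / (I3 : ℝ)) * ∑ t : Fin I3, ∑ k : Fin (min I1 I2), (if R ≤ (k : ℕ) then s t k ^ 2 else 0) ∧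
    ∀ (Y : Fin I1 → Fin R → Fin I3 → ℝ) (Z : Fin R → Fin I2 → Fin I3 → ℝ),
      frob (fun i j t => X i j t - XR i j t)
        ≤ frob (fun i j t => X i j t - tprod Y Z i j t) := by
  have herr : (frob (fun i j t => X i j t - XR i j t)) ^ 2
      = (1 / (I3 : ℝ)) * ∑ t : Fin I3, ∑ k : Fin (min I1 I2),
          (if R ≤ (k : ℕ) then s t k ^ 2 else 0) := by
    rw [frob_sq_eq_sum_norm_dftR_sq]
    congr 1
    refine Finset.sum_congr rfl fun t _ => ?_
    have h := sum_norm_sum_svd_sq (hU t) (hV t) fun k => if R ≤ (k : ℕ) then s t k else 0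
    simp only [ite_pow, ne_eq, OfNat.ofNat_ne_zero, not_false_eq_true, zero_pow] at h
    rw [← h]
    refine Finset.sum_congr rfl fun j _ => Finset.sum_congr rfl fun i _ => ?_
    rw [dftR_sub, hX, hXR, ← Finset.sum_sub_distrib]
    congr 2
    refine Finset.sum_congr rfl fun k _ => ?_
    obtain hk | hk := lt_or_ge (k : ℕ) R
    · simp [hk, hk.not_ge]
    · simp [hk, hk.not_gt]
  refine ⟨herr, fun Y Z => ?_⟩
  refine (sq_le_sq₀ (Real.sqrt_nonneg _) (Real.sqrt_nonneg _)).1 ?_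
  change frob _ ^ 2 ≤ frob _ ^ 2
  rw [herr, frob_sq_eq_sum_norm_dftR_sq]
  refine mul_le_mul_of_nonneg_left (Finset.sum_le_sum fun t _ => ?_) (by positivity)
  simp_rw [dftR_sub, hX, dftR_tprod]
  exact sum_tail_sq_le_sum_norm_svd_sub_mul_sq (hU t) (hV t) (hs_nonneg t)
    (fun k l h => hs_mono t k l h) (fun i l => dftR (Y i l) t) fun l j => dftR (Z l j) t

end TTT
end

section
/- Closedness of bounded-TTT-rank sets: for fixed mode sizes I1,…,IN, tube length T, and rank profile (r1,…,r_{N−1}), the set of tensors in ℝ^{I1×⋯×IN×T} admitting a TTT representation with tubal ranks at most (r1,…,r_{N−1}) is a closed subset of ℝ^{I1×⋯×IN×T}; consequently, every tensor has a best Frobenius-norm approximation in this set. -/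
open scoped BigOperators

namespace TTT

/-- The unit tube for circular convolution. -/
def deltaTube {T : ℕ} : Fin T → ℝ := fun t => if (t : ℕ) = 0 then 1 else 0

/-- Iterated circular convolution `c 0 ⊛ c 1 ⊛ ⋯ ⊛ c (n-1)` of a sequence of tubes. -/
def chainConv {T : ℕ} (c : ℕ → Fin T → ℝ) : ℕ → Fin T → ℝ
  | 0 => deltaTube
  | n + 1 => cconv (chainConv c n) (c n)

/-- `Z` has TTT-rank at most `(r 1, …, r (N-1))`: it is the contraction (via the t-product
along the tube mode) of cores of sizes `r' n × I n × r' (n+1) × T` with boundary ranks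
`r' 0 = r' N = 1` and internal ranks `r' n ≤ r n`. -/
def TTTrankLE (N T : ℕ) (I : ℕ → ℕ) (r : ℕ → ℕ)
    (Z : (∀ m : Fin N, Fin (I m.1)) → Fin T → ℝ) : Prop :=
  ∃ r' : ℕ → ℕ, r' 0 = 1 ∧ r' N = 1 ∧ (∀ n, 1 ≤ n → n < N → r' n ≤ r n) ∧
    ∃ G : ∀ n : ℕ, Fin (r' n) → Fin (I n) → Fin (r' (n + 1)) → Fin T → ℝ,
      ∀ idx t, Z idx t =
        ∑ ρ : (∀ m : Fin (N + 1), Fin (r' m.1)),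
          chainConv (fun n =>
            if h : n < N then
              G n (ρ ⟨n, by omega⟩) (idx ⟨n, h⟩) (ρ ⟨n + 1, by omega⟩)
            else fun _ => 0) N t

section Train

open scoped Matrix

/-- Every vector `w` over `R` can be written as `(w ⬝ᵥ p) • q`, with `p` and `q` ranging over a
compact set that does not depend on `w`. -/
def HasCompactNormalization (R : Type) [CommRing R] [TopologicalSpace R] : Prop :=
  ∀ (γ : Type) [Fintype γ], ∃ K : Set ((γ → R) × (γ → R)), IsCompact K ∧
    ∀ w : γ → R, ∃ p ∈ K, (w ⬝ᵥ p.1) • p.2 = w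

/-- Matrices with `s` rows factor through `s`-dimensional free modules along a compact family. -/
lemma HasCompactNormalization.exists_mul_mul_eq {R : Type} [CommRing R] [TopologicalSpace R]
    [IsTopologicalRing R] (hR : HasCompactNormalization R) (γ : Type) [Fintype γ] (s : ℕ) :
    ∃ K : Set (Matrix γ (Fin s) R × Matrix (Fin s) γ R), IsCompact K ∧
      ∀ G : Matrix (Fin s) γ R, ∃ p ∈ K, G * p.1 * p.2 = G := by
  induction s with
  | zero =>
    exact ⟨{0}, isCompact_singleton, fun G => ⟨0, rfl, by ext a; exact a.elim0⟩⟩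
  | succ s ih =>
    obtain ⟨K, hK, h⟩ := ih
    obtain ⟨K₀, hK₀, h₀⟩ := hR γ
    let F : (Matrix γ (Fin s) R × Matrix (Fin s) γ R) × ((γ → R) × (γ → R)) →
        Matrix γ (Fin (s + 1)) R × Matrix (Fin (s + 1)) γ R := fun x =>
      (Matrix.of fun c => Fin.cons (x.2.1 c - (x.1.1 *ᵥ (x.1.2 *ᵥ x.2.1)) c) (x.1.1 c),
        Matrix.of (Fin.cons x.2.2 x.1.2))
    have hF : Continuous F := by
      refine Continuous.prodMk (continuous_matrix fun c b => ?_) (continuous_matrix fun b c => ?_)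
      · refine Fin.cases ?_ (fun b => ?_) b
        · simp only [Matrix.of_apply, Fin.cons_zero]
          fun_prop
        · simp only [Matrix.of_apply, Fin.cons_succ]
          fun_prop
      · refine Fin.cases ?_ (fun b => ?_) b <;>
        · simp only [Matrix.of_apply]
          fun_prop
    refine ⟨F '' (K ×ˢ K₀), (hK.prod hK₀).image hF, fun G => ?_⟩
    obtain ⟨⟨P, Q⟩, hPQ, hG⟩ := h (Matrix.of fun a => G a.succ)
    obtain ⟨⟨p, q⟩, hpq, hw⟩ := h₀ (G 0 - (G 0 ᵥ* P) ᵥ* Q)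
    refine ⟨_, ⟨((P, Q), (p, q)), ⟨hPQ, hpq⟩, rfl⟩, ?_⟩
    have key (v : γ → R) : (v ᵥ* (F ((P, Q), (p, q))).1) ᵥ* (F ((P, Q), (p, q))).2
        = ((v - (v ᵥ* P) ᵥ* Q) ⬝ᵥ p) • q + (v ᵥ* P) ᵥ* Q := by
      have h1 : v ᵥ* (F ((P, Q), (p, q))).1
          = Fin.cons ((v - (v ᵥ* P) ᵥ* Q) ⬝ᵥ p) (v ᵥ* P) := by
        funext b
        refine Fin.cases ?_ (fun b => ?_) b
        · rw [Fin.cons_zero, sub_dotProduct, ← Matrix.dotProduct_mulVec,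
            ← Matrix.dotProduct_mulVec, ← dotProduct_sub]
          simp [F, Matrix.vecMul, dotProduct]
        · simp [F, Matrix.vecMul, dotProduct]
      rw [h1]
      funext c
      simp only [F, Matrix.vecMul, dotProduct, Fin.sum_univ_succ, Matrix.of_apply, Fin.cons_zero,
        Fin.cons_succ, Pi.add_apply, Pi.smul_apply, smul_eq_mul]
      rfl
    refine funext fun a => ?_
    rw [Matrix.mul_apply_eq_vecMul, Matrix.mul_apply_eq_vecMul, key]
    refine Fin.cases ?_ (fun a => ?_) a
    · rw [hw]; simp
    · have h2 : (G a.succ ᵥ* P) ᵥ* Q = G a.succ := by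
        have := congrFun hG a
        rwa [Matrix.mul_apply_eq_vecMul, Matrix.mul_apply_eq_vecMul] at this
      rw [h2]; simp

/-- Products `W * G` with `W` in a closed set stable under right multiplication form a closed
set. -/
lemma HasCompactNormalization.isClosed_mul {R : Type} [CommRing R] [TopologicalSpace R]
    [IsTopologicalRing R] [T2Space R] (hR : HasCompactNormalization R) {β γ : Type} [Fintype γ]
    {s : ℕ} {S : Set (Matrix β (Fin s) R)} (hS : IsClosed S)
    (hmul : ∀ W ∈ S, ∀ B : Matrix (Fin s) (Fin s) R, W * B ∈ S) :
    IsClosed {Z : Matrix β γ R | ∃ W ∈ S, ∃ G : Matrix (Fin s) γ R, Z = W * G} := by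
  obtain ⟨K, hK, h⟩ := hR.exists_mul_mul_eq γ s
  have : CompactSpace K := isCompact_iff_compactSpace.mp hK
  have hcl : IsClosed {x : Matrix β γ R × K |
      x.1 * x.2.1.1 ∈ S ∧ x.1 * x.2.1.1 * x.2.1.2 = x.1} := by
    refine IsClosed.inter (hS.preimage ?_) (isClosed_eq ?_ continuous_fst)
    · fun_prop
    · fun_prop
  convert isClosedMap_fst_of_compactSpace _ hcl using 1
  ext Z
  constructor
  · rintro ⟨W, hW, G, rfl⟩
    obtain ⟨p, hp, hG⟩ := h G
    refine ⟨(W * G, ⟨p, hp⟩), ⟨?_, ?_⟩, rfl⟩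
    · simpa only [Matrix.mul_assoc] using hmul W hW (G * p.1)
    · simpa only [Matrix.mul_assoc] using congrArg (W * ·) hG
  · rintro ⟨x, ⟨hS, hx⟩, rfl⟩
    exact ⟨_, hS, _, hx.symm⟩

/-- Tensor trains over `R` with bond dimensions `d`, with the last bond left open and an arbitrary
row vector on the first bond. -/
def trainSet (R : Type) [CommRing R] (I d : ℕ → ℕ) :
    ∀ n : ℕ, Set (Matrix (∀ m : Fin n, Fin (I m.1)) (Fin (d n)) R)
  | 0 => Set.univ
  | n + 1 => {Z | ∃ W ∈ trainSet R I d n, ∃ G : Fin (d n) → Fin (I n) → Fin (d (n + 1)) → R,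
      ∀ idx b, Z idx b = ∑ a, W (Fin.init idx) a * G a (idx (Fin.last n)) b}

lemma mul_mem_trainSet {R : Type} [CommRing R] {I d : ℕ → ℕ} {n : ℕ}
    {W : Matrix (∀ m : Fin n, Fin (I m.1)) (Fin (d n)) R} (hW : W ∈ trainSet R I d n)
    (B : Matrix (Fin (d n)) (Fin (d n)) R) : W * B ∈ trainSet R I d n := by
  cases n with
  | zero => trivial
  | succ n =>
    obtain ⟨V, hV, G, h⟩ := hW
    refine ⟨V, hV, fun a i b => ∑ c, G a i c * B c b, fun idx b => ?_⟩
    simp only [Matrix.mul_apply, h, Finset.sum_mul, Finset.mul_sum, mul_assoc]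
    exact Finset.sum_comm

lemma HasCompactNormalization.isClosed_trainSet {R : Type} [CommRing R] [TopologicalSpace R]
    [IsTopologicalRing R] [T2Space R] (hR : HasCompactNormalization R) (I d : ℕ → ℕ) (n : ℕ) :
    IsClosed (trainSet R I d n) := by
  induction n with
  | zero => exact isClosed_univ
  | succ n ih =>
    let F : Matrix (∀ m : Fin (n + 1), Fin (I m.1)) (Fin (d (n + 1))) R →
        Matrix (∀ m : Fin n, Fin (I m.1)) (Fin (I n) × Fin (d (n + 1))) R :=
      fun Z => Matrix.of fun idx c =>
        Z (Fin.snoc (α := fun m : Fin (n + 1) => Fin (I m.1)) idx c.1) c.2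
    have hF : Continuous F := continuous_matrix fun idx c => by
      simp only [F, Matrix.of_apply]
      fun_prop
    convert (hR.isClosed_mul ih (γ := Fin (I n) × Fin (d (n + 1)))
      fun W hW B => mul_mem_trainSet hW B).preimage hF using 1
    ext Z
    constructor
    · rintro ⟨W, hW, G, h⟩
      refine ⟨W, hW, Matrix.of fun a c => G a c.1 c.2, ?_⟩
      ext idx c
      simp [F, h, Matrix.mul_apply]
    · rintro ⟨W, hW, G, h⟩
      refine ⟨W, hW, fun a i b => G a (i, b), fun idx b => ?_⟩
      have := congrFun (congrFun h (Fin.init idx)) (idx (Fin.last n), b)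
      simpa [F, Matrix.mul_apply] using this

/-- The partial contraction of the first `n` cores, with the last bond left open. -/
def train {R : Type} [CommRing R] {I d : ℕ → ℕ}
    (G : ∀ n : ℕ, Fin (d n) → Fin (I n) → Fin (d (n + 1)) → R) :
    ∀ n : ℕ, (∀ m : Fin n, Fin (I m.1)) → Fin (d n) → R
  | 0 => fun _ _ => 1
  | n + 1 => fun idx b => ∑ a, train G n (Fin.init idx) a * G n a (idx (Fin.last n)) b

lemma sum_prod_mul_eq_sum_train_mul {R : Type} [CommRing R] {I d : ℕ → ℕ}
    (G : ∀ n : ℕ, Fin (d n) → Fin (I n) → Fin (d (n + 1)) → R) (n : ℕ)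
    (idx : ∀ m : Fin n, Fin (I m.1)) (f : Fin (d n) → R) :
    ∑ ρ : (∀ m : Fin (n + 1), Fin (d m.1)),
      (∏ m : Fin n, G m.1 (ρ m.castSucc) (idx m) (ρ m.succ)) * f (ρ (Fin.last n))
      = ∑ b, train G n idx b * f b := by
  induction n with
  | zero =>
    simp only [Finset.univ_eq_empty, Finset.prod_empty, train]
    exact Fintype.sum_equiv (Equiv.piUnique fun m : Fin 1 => Fin (d m.1)) _ _ fun ρ => rfl
  | succ n ih =>
    rw [← (Fin.snocEquiv fun m : Fin (n + 2) => Fin (d m.1)).sum_comp, Fintype.sum_prod_type]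
    refine Finset.sum_congr rfl fun b _ => ?_
    have := ih (Fin.init idx) fun a => G n a (idx (Fin.last n)) b * f b
    simp only [train, Finset.sum_mul, mul_assoc]
    refine Eq.trans (Finset.sum_congr rfl fun ρ _ => ?_) this
    rw [Fin.prod_univ_castSucc, mul_assoc]
    simp only [Fin.snocEquiv, Equiv.coe_fn_mk, Fin.snoc_castSucc, Fin.snoc_last, Fin.succ_last,
      ← Fin.castSucc_succ]
    rfl

lemma train_congr {R : Type} [CommRing R] {I d : ℕ → ℕ}
    {G G' : ∀ n : ℕ, Fin (d n) → Fin (I n) → Fin (d (n + 1)) → R} {n : ℕ}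
    (h : ∀ m < n, G m = G' m) : train G n = train G' n := by
  induction n with
  | zero => rfl
  | succ n ih =>
    funext idx b
    simp only [train, ih fun m hm => h m (hm.trans n.lt_succ_self), h n n.lt_succ_self]

lemma exists_train_eq {R : Type} [CommRing R] {I d : ℕ → ℕ} (hd : d 0 = 1) {n : ℕ} (hn : 1 ≤ n)
    {Z : Matrix (∀ m : Fin n, Fin (I m.1)) (Fin (d n)) R} (hZ : Z ∈ trainSet R I d n) :
    ∃ G : ∀ n : ℕ, Fin (d n) → Fin (I n) → Fin (d (n + 1)) → R,
      ∀ idx b, Z idx b = train G n idx b := by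
  induction n, hn using Nat.le_induction with
  | base =>
    obtain ⟨W, -, G, h⟩ := hZ
    refine ⟨Function.update (fun _ _ _ _ => 0) 0
      fun _ i b => ∑ a, W (fun m => m.elim0) a * G a i b, fun idx b => ?_⟩
    have h0 : Fin.init idx = fun m => m.elim0 := funext fun m => m.elim0
    rw [h, h0]
    simp [train, hd]
  | succ n hn ih =>
    obtain ⟨W, hW, G₀, h⟩ := hZ
    obtain ⟨G, hG⟩ := ih hW
    refine ⟨Function.update G n G₀, fun idx b => ?_⟩
    have : train (Function.update G n G₀) n = train G n :=
      train_congr fun m hm => Function.update_of_ne hm.ne _ _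
    simp [h, train, this, hG]

lemma sum_fin_dite_lt {R : Type} [AddCommMonoid R] {s t : ℕ} (hst : s ≤ t) (f : Fin s → R) :
    ∑ a : Fin t, (if h : a.1 < s then f ⟨a, h⟩ else 0) = ∑ a, f a := by
  symm
  refine Finset.sum_of_injOn (Fin.castLE hst) (Fin.castLE_injective hst).injOn (by simp) ?_ ?_
  · intro a _ ha
    refine dif_neg fun h => ha ⟨⟨a, h⟩, by simp, rfl⟩
  · intro a _
    simp

/-- Zero-padding the bonds of a tensor train. -/
lemma train_mem_trainSet {R : Type} [CommRing R] {I d d' : ℕ → ℕ}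
    (G : ∀ n : ℕ, Fin (d' n) → Fin (I n) → Fin (d' (n + 1)) → R) {n : ℕ}
    (h : ∀ m ≤ n, d' m ≤ d m) :
    (Matrix.of fun idx (b : Fin (d n)) => if hb : b.1 < d' n then train G n idx ⟨b, hb⟩ else 0)
      ∈ trainSet R I d n := by
  induction n with
  | zero => trivial
  | succ n ih =>
    refine ⟨_, ih fun m hm => h m (hm.trans n.le_succ), fun a i b =>
      if ha : a.1 < d' n then if hb : b.1 < d' (n + 1) then G n ⟨a, ha⟩ i ⟨b, hb⟩ else 0 else 0,
      fun idx b => ?_⟩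
    simp only [Matrix.of_apply]
    by_cases hb : b.1 < d' (n + 1)
    · simp only [hb, dite_true, train]
      rw [← sum_fin_dite_lt (h n n.le_succ)]
      refine Finset.sum_congr rfl fun a _ => ?_
      split_ifs <;> simp
    · simp [hb]

end Train

section Fourier

open ZMod ComplexConjugate

/-- The functions on `ZMod T` with Hermitian symmetry: the Fourier transforms of real tubes. -/
def hermitianSubring (T : ℕ) : Subring (ZMod T → ℂ) where
  carrier := {x | ∀ k, x (-k) = conj (x k)}
  mul_mem' hx hy k := by simp [hx k, hy k]
  one_mem' k := by simp
  add_mem' hx hy k := by simp [hx k, hy k]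
  zero_mem' k := by simp
  neg_mem' hx k := by simp [hx k]

lemma isClosed_hermitianSubring (T : ℕ) : IsClosed (hermitianSubring T : Set (ZMod T → ℂ)) := by
  have : (hermitianSubring T : Set (ZMod T → ℂ)) = ⋂ k, {x | x (-k) = conj (x k)} := by
    ext x
    simp only [Set.mem_iInter]
    rfl
  rw [this]
  exact isClosed_iInter fun k => isClosed_eq (continuous_apply _)
    (Complex.continuous_conj.comp (continuous_apply k))

lemma hasCompactNormalization_hermitianSubring (T : ℕ) :
    HasCompactNormalization (hermitianSubring T) := by
  intro γ _
  let B : Set (hermitianSubring T) :=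
    Subtype.val ⁻¹' (Set.univ.pi fun _ : ZMod T => Metric.closedBall (0 : ℂ) 1)
  have hB : IsCompact B :=
    (isClosed_hermitianSubring T).isClosedEmbedding_subtypeVal.isCompact_preimage
      (isCompact_univ_pi fun _ => isCompact_closedBall _ _)
  refine ⟨(Set.univ.pi fun _ => B) ×ˢ (Set.univ.pi fun _ => B),
    (isCompact_univ_pi fun _ => hB).prod (isCompact_univ_pi fun _ => hB), fun w => ?_⟩
  let ν : ZMod T → ℝ := fun k => √(∑ i, ‖(w i).1 k‖ ^ 2)
  have hw (i : γ) (k : ZMod T) : (w i).1 (-k) = conj ((w i).1 k) := (w i).2 k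
  have hν (k : ZMod T) : ν (-k) = ν k := by simp [ν, hw]
  have hle (i : γ) (k : ZMod T) : ‖(w i).1 k‖ ≤ ν k :=
    Real.le_sqrt_of_sq_le (Finset.single_le_sum (f := fun i => ‖(w i).1 k‖ ^ 2)
      (fun _ _ => by positivity) (Finset.mem_univ i))
  have hν0 (k : ZMod T) : 0 ≤ ν k := Real.sqrt_nonneg _
  have hsq (k : ZMod T) : ∑ i, (w i).1 k * conj ((w i).1 k) = (ν k : ℂ) * ν k := by
    rw [← Complex.ofReal_mul, Real.mul_self_sqrt (by positivity)]
    simp [Complex.mul_conj, Complex.normSq_eq_norm_sq]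
  let p : γ → hermitianSubring T := fun i =>
    ⟨fun k => conj ((w i).1 k) / ν k, fun k => by simp [hw, hν]⟩
  let q : γ → hermitianSubring T := fun i =>
    ⟨fun k => (w i).1 k / ν k, fun k => by simp [hw, hν]⟩
  have hbound (i : γ) (k : ZMod T) : ‖(w i).1 k‖ / ν k ≤ 1 := div_le_one_of_le₀ (hle i k) (hν0 k)
  refine ⟨(p, q), ⟨fun i _ k _ => ?_, fun i _ k _ => ?_⟩, ?_⟩
  · simpa [p, abs_of_nonneg (hν0 k)] using hbound i k
  · simpa [q, abs_of_nonneg (hν0 k)] using hbound i k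
  · funext i
    refine Subtype.ext (funext fun k => ?_)
    have h1 : ((w ⬝ᵥ p) • q) i = (∑ j, w j * p j) * q i := rfl
    have h2 : ((∑ j, w j * p j : hermitianSubring T) : ZMod T → ℂ) k
        = (ν k : ℂ) * ν k / ν k := by
      rw [← hsq, Finset.sum_div]
      simp [p, mul_div_assoc]
    simp only [h1, Subring.coe_mul, Pi.mul_apply, h2]
    by_cases h0 : ν k = 0
    · have : (w i).1 k = 0 := norm_le_zero_iff.mp (h0 ▸ hle i k)
      simp [this, h0]
    · have : (ν k : ℂ) ≠ 0 := by exact_mod_cast h0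
      simp only [q]
      field_simp

/-- The discrete Fourier transform of real tubes. -/
noncomputable def hat (n : ℕ) : (Fin (n + 1) → ℝ) →+ hermitianSubring (n + 1) where
  toFun x := ⟨𝓕 fun j : ZMod (n + 1) => ((x j : ℝ) : ℂ), fun k => by
    simp [dft_apply, ← AddChar.map_neg_eq_conj]⟩
  map_zero' := Subtype.ext <| (congrArg 𝓕 (funext fun _ => Complex.ofReal_zero)).trans
    (map_zero 𝓕)
  map_add' x y := Subtype.ext <| (congrArg 𝓕 (funext fun _ => Complex.ofReal_add _ _)).trans
    (map_add 𝓕 (fun j : ZMod (n + 1) => ((x j : ℝ) : ℂ)) fun j : ZMod (n + 1) => ((y j : ℝ) : ℂ))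

lemma coe_hat (n : ℕ) (x : Fin (n + 1) → ℝ) :
    (hat n x : ZMod (n + 1) → ℂ) = 𝓕 fun j : ZMod (n + 1) => ((x j : ℝ) : ℂ) := rfl

lemma hat_bijective (n : ℕ) : Function.Bijective (hat n) := by
  constructor
  · intro x y h
    have := (dft (N := n + 1) (E := ℂ)).injective
      (show 𝓕 (fun j : ZMod (n + 1) => ((x j : ℝ) : ℂ)) =
          𝓕 fun j : ZMod (n + 1) => ((y j : ℝ) : ℂ) from
        congrArg Subtype.val h)
    funext j
    exact_mod_cast congrFun this j
  · intro y
    have hreal (j : ZMod (n + 1)) : conj (𝓕⁻ y.1 j) = 𝓕⁻ y.1 j := by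
      simp only [invDFT_apply, smul_eq_mul, map_mul, map_sum, map_inv₀, map_natCast]
      congr 1
      refine Fintype.sum_equiv (Equiv.neg _) _ _ fun k => ?_
      rw [Equiv.neg_apply, y.2 k, neg_mul, AddChar.map_neg_eq_conj]
    refine ⟨fun j => (𝓕⁻ y.1 j).re, Subtype.ext ?_⟩
    rw [coe_hat]
    have : (fun j : ZMod (n + 1) => (((𝓕⁻ y.1 j).re : ℝ) : ℂ)) = 𝓕⁻ y.1 :=
      funext fun j => Complex.conj_eq_iff_re.mp (hreal j)
    exact (congrArg _ this).trans (LinearEquiv.apply_symm_apply _ _)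

lemma continuous_hat (n : ℕ) : Continuous (hat n) := by
  refine Continuous.subtype_mk (continuous_pi fun k => ?_) _
  simp only [dft_apply]
  fun_prop

lemma hat_deltaTube (n : ℕ) : hat n deltaTube = 1 := by
  have h (j : ZMod (n + 1)) : ((deltaTube (T := n + 1) j : ℝ) : ℂ) = if j = 0 then 1 else 0 := by
    have : (j : Fin (n + 1)).val = 0 ↔ j = 0 := Fin.val_eq_zero_iff
    refine (congrArg Complex.ofReal (if_congr this rfl rfl)).trans ?_
    split_ifs <;> simp
  refine Subtype.ext (funext fun k => ?_)
  rw [coe_hat, dft_apply]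
  simp [h]

lemma hat_cconv (n : ℕ) (x y : Fin (n + 1) → ℝ) : hat n (cconv x y) = hat n x * hat n y := by
  have h (j : ZMod (n + 1)) : ((cconv x y j : ℝ) : ℂ)
      = ∑ m : ZMod (n + 1), ((x m : ℝ) : ℂ) * ((y (j - m : ZMod (n + 1)) : ℝ) : ℂ) :=
    (Complex.ofReal_sum _ _).trans (Finset.sum_congr rfl fun _ _ => Complex.ofReal_mul _ _)
  refine Subtype.ext (funext fun k => ?_)
  simp only [Subring.coe_mul, Pi.mul_apply, coe_hat, dft_apply, smul_eq_mul, h, Finset.mul_sum,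
    Finset.sum_mul]
  rw [Finset.sum_comm]
  conv_rhs => rw [Finset.sum_comm]
  refine Finset.sum_congr rfl fun m _ => ?_
  refine Fintype.sum_equiv (Equiv.subRight m) _ _ fun j => ?_
  have : -(j * k) = -(m * k) + -((j - m) * k) := by ring
  rw [this, AddChar.map_add_eq_mul, mul_mul_mul_comm, Equiv.subRight_apply]

lemma hat_chainConv (n : ℕ) (c : ℕ → Fin (n + 1) → ℝ) (k : ℕ) :
    hat n (chainConv c k) = ∏ m : Fin k, hat n (c m) := by
  induction k with
  | zero => simp [chainConv, hat_deltaTube]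
  | succ k ih => simp [chainConv, hat_cconv, ih, Fin.prod_univ_castSucc]

end Fourier

lemma hat_sum_chainConv (n N : ℕ) {I d : ℕ → ℕ}
    (G : ∀ m : ℕ, Fin (d m) → Fin (I m) → Fin (d (m + 1)) → Fin (n + 1) → ℝ)
    (idx : ∀ m : Fin N, Fin (I m.1)) :
    hat n (∑ ρ : (∀ m : Fin (N + 1), Fin (d m.1)),
      chainConv (fun m =>
        if h : m < N then
          G m (ρ ⟨m, by omega⟩) (idx ⟨m, h⟩) (ρ ⟨m + 1, by omega⟩)
        else fun _ => 0) N)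
      = ∑ b, train (fun m a i b => hat n (G m a i b)) N idx b := by
  have := sum_prod_mul_eq_sum_train_mul (fun m a i b => hat n (G m a i b)) N idx fun _ => 1
  simp only [mul_one] at this
  rw [← this, map_sum]
  refine Finset.sum_congr rfl fun ρ _ => ?_
  rw [hat_chainConv]
  refine Finset.prod_congr rfl fun m _ => ?_
  simp only [m.2, dite_true]
  rfl

lemma TTTrankLE_iff_mem_trainSet {n N : ℕ} (hN : 1 ≤ N) {I r : ℕ → ℕ}
    {Z : (∀ m : Fin N, Fin (I m.1)) → Fin (n + 1) → ℝ} :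
    TTTrankLE N (n + 1) I r Z ↔
      (Matrix.of fun idx _ => hat n (Z idx)) ∈ trainSet (hermitianSubring (n + 1)) I
        (fun m => if m = 0 ∨ m = N then 1 else r m) N := by
  set d : ℕ → ℕ := fun m => if m = 0 ∨ m = N then 1 else r m with hd
  have hd0 : d 0 = 1 := by simp [hd]
  have hdN : d N = 1 := by simp [hd]
  constructor
  · rintro ⟨r', h0, h1, hr, G, hZ⟩
    have hle : ∀ m ≤ N, r' m ≤ d m := by
      intro m hm
      by_cases h : m = 0 ∨ m = N
      · rcases h with rfl | rfl
        · rw [h0, hd0]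
        · rw [h1, hdN]
      · simp only [hd, h, if_false]
        exact hr m (by omega) (by omega)
    convert train_mem_trainSet (fun m a i b => hat n (G m a i b)) hle using 1
    ext1 idx b
    have hb : b.1 < r' N := by
      have : b.1 < d N := b.2
      omega
    have : Subsingleton (Fin (r' N)) := by rw [h1]; infer_instance
    have hZ' := hat_sum_chainConv n N G idx
    rw [Fintype.sum_subsingleton (train _ N idx) ⟨b.1, hb⟩] at hZ'
    simp only [Matrix.of_apply, hb, dite_true, ← hZ']
    congr 1
    funext t
    rw [hZ, Finset.sum_apply]
  · intro hZ
    obtain ⟨G, hG⟩ := exists_train_eq hd0 hN hZ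
    choose G' hG' using fun m a i b => (hat_bijective n).2 (G m a i b)
    refine ⟨d, hd0, hdN, fun m hm hmN => ?_, G', fun idx t => ?_⟩
    · have : ¬ (m = 0 ∨ m = N) := by omega
      simp [hd, this]
    · rw [← Finset.sum_apply]
      refine congrFun ((hat_bijective n).1 ?_) t
      rw [hat_sum_chainConv]
      simp only [hG', ← hG, Matrix.of_apply, Finset.sum_const, Finset.card_univ, Fintype.card_fin,
        hdN, one_smul]

lemma isClosed_setOf_TTTrankLE (N T : ℕ) (I r : ℕ → ℕ) :
    IsClosed {Z : (∀ m : Fin N, Fin (I m.1)) → Fin T → ℝ | TTTrankLE N T I r Z} := by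
  cases T with
  | zero => exact Set.Subsingleton.isClosed fun _ _ _ _ => Subsingleton.elim _ _
  | succ n =>
    rcases Nat.eq_zero_or_pos N with rfl | hN
    · refine Set.Subsingleton.isClosed ?_
      rintro Z ⟨r', h0, -, -, G, hZ⟩ Z' ⟨s', h0', -, -, G', hZ'⟩
      ext idx t
      rw [hZ, hZ']
      simp [chainConv, h0, h0']
    · simp only [TTTrankLE_iff_mem_trainSet hN]
      refine IsClosed.preimage (continuous_matrix fun idx _ => ?_)
        ((hasCompactNormalization_hermitianSubring (n + 1)).isClosed_trainSet I _ N)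
      exact (continuous_hat n).comp (continuous_apply idx)

lemma exists_TTTrankLE (N T : ℕ) (I r : ℕ → ℕ) : ∃ Z, TTTrankLE N T I r Z := by
  refine ⟨_, fun m => if m = 0 ∨ m = N then 1 else r m, by simp, by simp, fun m hm hmN => ?_,
    fun _ _ _ _ _ => 0, fun _ _ => rfl⟩
  have : ¬ (m = 0 ∨ m = N) := by omega
  simp [this]

/-- A nonempty closed set of arrays contains a nearest point in the Frobenius norm. -/
lemma exists_forall_sqrt_sum_sq_sub_le {α β : Type*} [Fintype α] [Fintype β]
    {S : Set (α → β → ℝ)} (hS : IsClosed S) (hne : S.Nonempty) (X : α → β → ℝ) :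
    ∃ Y ∈ S, ∀ Z ∈ S, √(∑ i, ∑ t, (X i t - Y i t) ^ 2) ≤ √(∑ i, ∑ t, (X i t - Z i t) ^ 2) := by
  let φ : (α → β → ℝ) → ℝ := fun Y => √(∑ i, ∑ t, (X i t - Y i t) ^ 2)
  have hφ : Continuous φ := by fun_prop
  obtain ⟨Y₀, hY₀⟩ := hne
  have hdist (Y : α → β → ℝ) : dist Y X ≤ φ Y := by
    refine (dist_pi_le_iff (Real.sqrt_nonneg _)).mpr fun i =>
      (dist_pi_le_iff (Real.sqrt_nonneg _)).mpr fun t => ?_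
    rw [dist_comm, Real.dist_eq]
    refine Real.abs_le_sqrt ?_
    calc (X i t - Y i t) ^ 2 ≤ ∑ t, (X i t - Y i t) ^ 2 :=
          Finset.single_le_sum (f := fun t => (X i t - Y i t) ^ 2)
            (fun _ _ => sq_nonneg _) (Finset.mem_univ t)
      _ ≤ ∑ i, ∑ t, (X i t - Y i t) ^ 2 :=
          Finset.single_le_sum (f := fun i => ∑ t, (X i t - Y i t) ^ 2)
            (fun _ _ => Finset.sum_nonneg fun _ _ => sq_nonneg _) (Finset.mem_univ i)
  have hK : IsCompact (S ∩ {Y | φ Y ≤ φ Y₀}) :=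
    (isCompact_closedBall X (φ Y₀)).of_isClosed_subset
      (hS.inter (isClosed_le hφ continuous_const)) fun Y hY => (hdist Y).trans hY.2
  obtain ⟨Y, hY, hmin⟩ := hK.exists_isMinOn ⟨Y₀, hY₀, le_refl (φ Y₀)⟩ hφ.continuousOn
  refine ⟨Y, hY.1, fun Z hZ => ?_⟩
  rcases le_total (φ Z) (φ Y₀) with h | h
  · exact hmin ⟨hZ, h⟩
  · exact hY.2.trans h

/-- the set of tensors of TTT-rank at most `(r 1, …, r (N-1))` is closed;
consequently, every tensor has a best Frobenius-norm approximation in this set. -/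
theorem tttrank_set_closed_and_best_approx (N T : ℕ) (I : ℕ → ℕ) (r : ℕ → ℕ) :
    IsClosed {Z : (∀ m : Fin N, Fin (I m.1)) → Fin T → ℝ | TTTrankLE N T I r Z} ∧
    ∀ X : (∀ m : Fin N, Fin (I m.1)) → Fin T → ℝ,
      ∃ Y, TTTrankLE N T I r Y ∧
        ∀ Z, TTTrankLE N T I r Z →
          Real.sqrt (∑ idx, ∑ t, (X idx t - Y idx t) ^ 2)
            ≤ Real.sqrt (∑ idx, ∑ t, (X idx t - Z idx t) ^ 2) := by
  exact ⟨isClosed_setOf_TTTrankLE N T I r, exists_forall_sqrt_sum_sq_sub_le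
    (isClosed_setOf_TTTrankLE N T I r) (exists_TTTrankLE N T I r)⟩

end TTT
end
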